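/- There exists a universal constant c > 0 such that for every integer d ≥ 1, every real r > 0, and every real α with 1/(2√d) < α < 1/2, the Lebesgue volume of the hyperspherical cap {x ∈ ℝ^d : ‖x‖₂ ≤ r and x₁ ≥ α·r} is at least c·(1/(α·√d))·(1 − α²)^{(d+1)/2}·vol(B₂(0,r)), where B₂(0,r) = {x ∈ ℝ^d : ‖x‖₂ ≤ r} and ‖·‖₂ is the Euclidean norm. -/

import Mathlib

open MeasureTheory

/-- The squared Euclidean norm splits off the first coordinate. -/
theorem EuclideanSpace.norm_sq_eq_zero_add_tail {n : ℕ} (x : EuclideanSpace ℝ (Fin (n + 1))) :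
    ‖x‖ ^ 2 = x 0 ^ 2 + ‖WithLp.toLp 2 fun i : Fin n => x i.succ‖ ^ 2 := by
  simp [EuclideanSpace.norm_sq_eq, Fin.sum_univ_succ]

/-- Splitting off the first coordinate is measure preserving. -/
theorem EuclideanSpace.measurePreserving_zero_tail (n : ℕ) :
    MeasurePreserving (fun x : EuclideanSpace ℝ (Fin (n + 1)) =>
      (x 0, (WithLp.toLp 2 fun i : Fin n => x i.succ : EuclideanSpace ℝ (Fin n)))) := by
  have h := (((MeasurePreserving.id (volume : Measure ℝ)).prod
    (PiLp.volume_preserving_toLp (Fin n))).comp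
    (volume_preserving_piFinSuccAbove (fun _ : Fin (n + 1) => ℝ) 0)).comp
    (PiLp.volume_preserving_ofLp (Fin (n + 1)))
  exact h

/-- The volume of a slab of the unit ball, by slicing along the first coordinate. -/
theorem EuclideanSpace.volume_norm_le_one_inter_slab (n : ℕ) {S : Set ℝ} (hS : MeasurableSet S) :
    volume {x : EuclideanSpace ℝ (Fin (n + 1)) | ‖x‖ ≤ 1 ∧ x 0 ∈ S} =
      ∫⁻ t in S, volume {y : EuclideanSpace ℝ (Fin n) | t ^ 2 + ‖y‖ ^ 2 ≤ 1} := by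
  have hT : MeasurableSet {p : ℝ × EuclideanSpace ℝ (Fin n) |
      p.1 ^ 2 + ‖p.2‖ ^ 2 ≤ 1 ∧ p.1 ∈ S} := by
    refine MeasurableSet.inter (s₁ := {p : ℝ × EuclideanSpace ℝ (Fin n) |
      p.1 ^ 2 + ‖p.2‖ ^ 2 ≤ 1}) ?_ (measurable_fst hS)
    exact measurableSet_le (by fun_prop) (by fun_prop)
  have h := (EuclideanSpace.measurePreserving_zero_tail n).measure_preimage hT.nullMeasurableSet
  have hpre : {x : EuclideanSpace ℝ (Fin (n + 1)) | ‖x‖ ≤ 1 ∧ x 0 ∈ S} =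
      (fun x : EuclideanSpace ℝ (Fin (n + 1)) =>
        (x 0, (WithLp.toLp 2 fun i : Fin n => x i.succ : EuclideanSpace ℝ (Fin n)))) ⁻¹'
      {p | p.1 ^ 2 + ‖p.2‖ ^ 2 ≤ 1 ∧ p.1 ∈ S} := by
    ext x
    simp only [Set.mem_ofPred_eq, Set.mem_preimage, ← EuclideanSpace.norm_sq_eq_zero_add_tail]
    rw [sq_le_one_iff₀ (norm_nonneg x)]
  rw [hpre, h, Measure.volume_eq_prod, Measure.prod_apply hT, ← lintegral_indicator hS]
  refine lintegral_congr fun t => ?_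
  by_cases ht : t ∈ S <;> simp [ht]

/-- The unit ball of `ℝⁿ⁺¹` has volume at most `√(2π/n)` times that of the unit ball of `ℝⁿ`. -/
theorem EuclideanSpace.volume_closedBall_one_succ_le {n : ℕ} (hn : 0 < n) :
    volume (Metric.closedBall (0 : EuclideanSpace ℝ (Fin (n + 1))) 1) ≤
      ENNReal.ofReal √(2 * Real.pi / n) *
        volume (Metric.ball (0 : EuclideanSpace ℝ (Fin n)) 1) := by
  have hn' : (0 : ℝ) < n := by exact_mod_cast hn
  have hball : Metric.closedBall (0 : EuclideanSpace ℝ (Fin (n + 1))) 1 =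
      {x | ‖x‖ ≤ 1 ∧ x 0 ∈ Set.univ} := by
    ext x; simp
  have hslice : ∀ t : ℝ, volume {y : EuclideanSpace ℝ (Fin n) | t ^ 2 + ‖y‖ ^ 2 ≤ 1} ≤
      ENNReal.ofReal (Real.exp (-(n / 2 : ℝ) * t ^ 2)) *
        volume (Metric.ball (0 : EuclideanSpace ℝ (Fin n)) 1) := by
    intro t
    have hsub : {y : EuclideanSpace ℝ (Fin n) | t ^ 2 + ‖y‖ ^ 2 ≤ 1} ⊆
        Metric.closedBall 0 (Real.exp (-t ^ 2 / 2)) := by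
      intro y hy
      rw [Set.mem_ofPred_eq] at hy
      rw [mem_closedBall_zero_iff]
      refine le_of_sq_le_sq ?_ (Real.exp_nonneg _)
      rw [← Real.exp_nat_mul]
      have := Real.add_one_le_exp (((2 : ℕ) : ℝ) * (-t ^ 2 / 2))
      push_cast at this ⊢
      linarith
    refine (measure_mono hsub).trans_eq ?_
    rw [Measure.addHaar_closedBall _ _ (Real.exp_nonneg _), finrank_euclideanSpace_fin,
      ← Real.exp_nat_mul]
    congr 3
    ring
  rw [hball, EuclideanSpace.volume_norm_le_one_inter_slab n MeasurableSet.univ,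
    Measure.restrict_univ]
  refine (lintegral_mono hslice).trans_eq ?_
  rw [lintegral_mul_const _ (by fun_prop), ← ofReal_integral_eq_lintegral_ofReal
    (integrable_exp_neg_mul_sq (by positivity)) (.of_forall fun _ => (Real.exp_pos _).le),
    integral_gaussian]
  congr 3
  field_simp

/-- An antiderivative of `t ↦ t √(1 - t²)ⁿ`. -/
theorem Real.integral_mul_sqrt_one_sub_sq_pow (n : ℕ) {a b : ℝ} (ha : -1 < a) (hab : a ≤ b)
    (hb : b < 1) :
    ∫ t in a..b, t * √(1 - t ^ 2) ^ n =
      (√(1 - a ^ 2) ^ (n + 2) - √(1 - b ^ 2) ^ (n + 2)) / (n + 2) := by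
  have hderiv : ∀ t ∈ Set.uIcc a b, HasDerivAt
      (fun t : ℝ => -(√(1 - t ^ 2) ^ (n + 2) / (n + 2))) (t * √(1 - t ^ 2) ^ n) t := by
    intro t ht
    rw [Set.uIcc_of_le hab] at ht
    have hpos : 0 < 1 - t ^ 2 := by nlinarith [ht.1, ht.2]
    have hs : √(1 - t ^ 2) ≠ 0 := (Real.sqrt_pos.2 hpos).ne'
    have h := (((((hasDerivAt_pow 2 t).const_sub 1).sqrt hpos.ne').fun_pow (n + 2)).div_const
      ((n : ℝ) + 2)).neg
    refine h.congr_deriv ?_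
    have hn : (n : ℝ) + 2 ≠ 0 := by positivity
    push_cast
    simp only [pow_succ]
    field_simp
  rw [intervalIntegral.integral_eq_sub_of_hasDerivAt hderiv
    (Continuous.intervalIntegrable (by fun_prop) _ _)]
  ring

/-- If `α² (n + 2) ≥ 1/4`, then `√(1 - (2α)²)ⁿ⁺²` is smaller than `√(1 - α²)ⁿ⁺²` by a
constant factor. -/
theorem Real.sqrt_one_sub_two_mul_sq_pow_le {n : ℕ} {α : ℝ} (hα₀ : 0 ≤ α) (hα : α < 1 / 2)
    (hαn : 1 / 4 ≤ α ^ 2 * (n + 2)) :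
    √(1 - (2 * α) ^ 2) ^ (n + 2) ≤ 8 / 11 * √(1 - α ^ 2) ^ (n + 2) := by
  have hle : √(1 - (2 * α) ^ 2) ≤ Real.exp (-(3 * α ^ 2 / 2)) * √(1 - α ^ 2) := by
    refine Real.sqrt_le_iff.2 ⟨by positivity, ?_⟩
    rw [mul_pow _ (√_), Real.sq_sqrt (by nlinarith), ← Real.exp_nat_mul]
    have h := Real.add_one_le_exp (((2 : ℕ) : ℝ) * -(3 * α ^ 2 / 2))
    push_cast at h ⊢
    nlinarith [mul_le_mul_of_nonneg_right h (show 0 ≤ 1 - α ^ 2 by nlinarith), sq_nonneg (α ^ 2)]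
  have hexp : Real.exp (-(3 * α ^ 2 / 2)) ^ (n + 2) ≤ 8 / 11 := by
    rw [← Real.exp_nat_mul]
    have h1 : ((n + 2 : ℕ) : ℝ) * -(3 * α ^ 2 / 2) ≤ -(3 / 8) := by
      push_cast; nlinarith
    refine (Real.exp_le_exp.2 h1).trans ?_
    rw [Real.exp_neg, inv_le_comm₀ (Real.exp_pos _) (by norm_num)]
    linarith [Real.add_one_le_exp (3 / 8 : ℝ)]
  calc √(1 - (2 * α) ^ 2) ^ (n + 2)
      ≤ (Real.exp (-(3 * α ^ 2 / 2)) * √(1 - α ^ 2)) ^ (n + 2) := by gcongr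
    _ ≤ 8 / 11 * √(1 - α ^ 2) ^ (n + 2) := by rw [mul_pow]; gcongr

/-- A lower bound for the cap of the unit ball of `ℝⁿ⁺¹` in terms of the unit ball of `ℝⁿ`. -/
theorem EuclideanSpace.le_volume_unit_cap {n : ℕ} {α : ℝ} (hα₀ : 0 < α) (hα : α < 1 / 2)
    (hαn : 1 / 4 ≤ α ^ 2 * (n + 2)) :
    ENNReal.ofReal (3 / 22 * √(1 - α ^ 2) ^ (n + 2) / (α * (n + 2))) *
        volume (Metric.ball (0 : EuclideanSpace ℝ (Fin n)) 1) ≤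
      volume {x : EuclideanSpace ℝ (Fin (n + 1)) | ‖x‖ ≤ 1 ∧ α ≤ x 0} := by
  have hslice : ∀ t ∈ Set.Ioc α (2 * α),
      ENNReal.ofReal (1 / (2 * α) * (t * √(1 - t ^ 2) ^ n)) *
        volume (Metric.ball (0 : EuclideanSpace ℝ (Fin n)) 1) ≤
      volume {y : EuclideanSpace ℝ (Fin n) | t ^ 2 + ‖y‖ ^ 2 ≤ 1} := by
    intro t ht
    have hsub : Metric.closedBall 0 √(1 - t ^ 2) ⊆
        {y : EuclideanSpace ℝ (Fin n) | t ^ 2 + ‖y‖ ^ 2 ≤ 1} := by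
      intro y hy
      rw [mem_closedBall_zero_iff] at hy
      have h := (Real.le_sqrt (norm_nonneg y) (by nlinarith [ht.1, ht.2])).1 hy
      rw [Set.mem_ofPred_eq]
      linarith
    refine le_trans ?_ (measure_mono hsub)
    rw [Measure.addHaar_closedBall _ _ (Real.sqrt_nonneg _), finrank_euclideanSpace_fin]
    gcongr
    rw [← mul_assoc]
    refine mul_le_of_le_one_left (by positivity) ?_
    rw [one_div_mul_eq_div]
    exact div_le_one_of_le₀ ht.2 (by positivity)
  have hcap : {x : EuclideanSpace ℝ (Fin (n + 1)) | ‖x‖ ≤ 1 ∧ x 0 ∈ Set.Ioc α (2 * α)} ⊆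
      {x | ‖x‖ ≤ 1 ∧ α ≤ x 0} := fun x hx => ⟨hx.1, hx.2.1.le⟩
  refine le_trans ?_ (measure_mono hcap)
  rw [EuclideanSpace.volume_norm_le_one_inter_slab n measurableSet_Ioc]
  refine le_trans ?_ (setLIntegral_mono' measurableSet_Ioc hslice)
  have hint : IntegrableOn (fun t : ℝ => 1 / (2 * α) * (t * √(1 - t ^ 2) ^ n))
      (Set.Ioc α (2 * α)) :=
    (Continuous.integrableOn_Icc (by fun_prop)).mono_set Set.Ioc_subset_Icc_self
  have hnonneg : 0 ≤ᵐ[volume.restrict (Set.Ioc α (2 * α))]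
      fun t : ℝ => 1 / (2 * α) * (t * √(1 - t ^ 2) ^ n) := by
    filter_upwards [ae_restrict_mem measurableSet_Ioc] with t ht
    have : 0 < t := hα₀.trans ht.1
    simp only [Pi.zero_apply]
    positivity
  rw [lintegral_mul_const _ (by fun_prop), ← ofReal_integral_eq_lintegral_ofReal hint hnonneg,
    ← intervalIntegral.integral_of_le (by linarith), intervalIntegral.integral_const_mul,
    Real.integral_mul_sqrt_one_sub_sq_pow n (by linarith) (by linarith) (by linarith)]
  gcongr
  have h := Real.sqrt_one_sub_two_mul_sq_pow_le hα₀.le hα hαn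
  rw [one_div_mul_eq_div, div_div, div_le_div_iff₀ (by positivity) (by positivity)]
  have hpos : 0 < α * ((n : ℝ) + 2) := by positivity
  nlinarith [mul_le_mul_of_nonneg_right h hpos.le]

/-- The cap of the ball of radius `r` is a dilation of the cap of the unit ball. -/
theorem EuclideanSpace.volume_cap_eq {d : ℕ} (i : Fin d) {r : ℝ} (hr : 0 < r) (α : ℝ) :
    volume {x : EuclideanSpace ℝ (Fin d) | ‖x‖ ≤ r ∧ α * r ≤ x i} =
      ENNReal.ofReal (r ^ d) * volume {x : EuclideanSpace ℝ (Fin d) | ‖x‖ ≤ 1 ∧ α ≤ x i} := by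
  have h : {x : EuclideanSpace ℝ (Fin d) | ‖x‖ ≤ r ∧ α * r ≤ x i} =
      (fun x => r⁻¹ • x) ⁻¹' {x : EuclideanSpace ℝ (Fin d) | ‖x‖ ≤ 1 ∧ α ≤ x i} := by
    ext x
    simp only [Set.mem_ofPred_eq, Set.mem_preimage, norm_smul, norm_inv, Real.norm_eq_abs,
      abs_of_pos hr, PiLp.smul_apply, smul_eq_mul]
    rw [inv_mul_le_one₀ hr, le_inv_mul_iff₀ hr, mul_comm r]
  rw [h, Measure.addHaar_preimage_smul _ (inv_ne_zero hr.ne'), finrank_euclideanSpace_fin,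
    inv_pow, inv_inv, abs_of_pos (by positivity)]

/-- **Volume of a hyperspherical cap.**  There is a universal constant `c > 0` such that for
every `d ≥ 1`, `r > 0` and `α ∈ (1/(2√d), 1/2)`, the Lebesgue volume of the hyperspherical cap
`{x ∈ ℝ^d : ‖x‖₂ ≤ r, x₁ ≥ α r}` is at least
`c · (1/(α√d)) · (1 - α²)^{(d+1)/2} · vol(B₂(0,r))`. -/
theorem hyperspherical_cap_volume :
    ∃ c : ℝ, 0 < c ∧
      ∀ (d : ℕ) (hd : 0 < d) (r : ℝ), 0 < r →
        ∀ α : ℝ, 1 / (2 * Real.sqrt d) < α → α < 1 / 2 →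
          ENNReal.ofReal
              (c * (1 / (α * Real.sqrt d)) * (1 - α ^ 2) ^ (((d : ℝ) + 1) / 2)) *
            volume (Metric.closedBall (0 : EuclideanSpace ℝ (Fin d)) r) ≤
          volume {x : EuclideanSpace ℝ (Fin d) | ‖x‖ ≤ r ∧ α * r ≤ x ⟨0, hd⟩} := by
  refine ⟨1 / 100, by norm_num, fun d hd r hr α hα₁ hα₂ => ?_⟩
  obtain ⟨m, rfl⟩ : ∃ m, d = m + 1 := ⟨d - 1, by omega⟩
  have hm : 0 < m := by
    rcases Nat.eq_zero_or_pos m with rfl | h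
    · norm_num at hα₁ hα₂
      linarith
    · exact h
  have hm' : (1 : ℝ) ≤ m := by exact_mod_cast hm
  have hsd : 0 < √((m + 1 : ℕ) : ℝ) := Real.sqrt_pos.2 (by positivity)
  have hsq : √((m + 1 : ℕ) : ℝ) ^ 2 = m + 1 := by
    rw [Real.sq_sqrt (by positivity)]; push_cast; ring
  have hα₀ : 0 < α := lt_trans (by positivity) hα₁
  have hαd : 1 / 4 ≤ α ^ 2 * ((m : ℝ) + 2) := by
    have h : 1 < α * (2 * √((m + 1 : ℕ) : ℝ)) := (div_lt_iff₀ (by positivity)).1 hα₁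
    nlinarith
  have hrpow : (1 - α ^ 2) ^ ((((m + 1 : ℕ) : ℝ) + 1) / 2) = √(1 - α ^ 2) ^ (m + 2) := by
    rw [Real.sqrt_eq_rpow, ← Real.rpow_natCast _ (m + 2), ← Real.rpow_mul (by nlinarith)]
    congr 1
    push_cast
    ring
  have hconst : 1 / 100 * (1 / (α * √((m + 1 : ℕ) : ℝ))) * √(1 - α ^ 2) ^ (m + 2) *
      √(2 * Real.pi / m) ≤ 3 / 22 * √(1 - α ^ 2) ^ (m + 2) / (α * (m + 2)) := by
    have hsqrt : √(2 * Real.pi / m) ≤ 4 / √((m + 1 : ℕ) : ℝ) := by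
      refine Real.sqrt_le_iff.2 ⟨by positivity, ?_⟩
      rw [div_pow, hsq, div_le_div_iff₀ (by positivity) (by positivity)]
      nlinarith [Real.pi_le_four]
    calc _ ≤ 1 / 100 * (1 / (α * √((m + 1 : ℕ) : ℝ))) * √(1 - α ^ 2) ^ (m + 2) *
          (4 / √((m + 1 : ℕ) : ℝ)) := by gcongr
      _ = √(1 - α ^ 2) ^ (m + 2) / α * (1 / 25 / √((m + 1 : ℕ) : ℝ) ^ 2) := by
          field_simp; ring
      _ ≤ √(1 - α ^ 2) ^ (m + 2) / α * (3 / 22 / (m + 2)) := by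
          rw [hsq]
          refine mul_le_mul_of_nonneg_left ?_ (by positivity)
          rw [div_le_div_iff₀ (by positivity) (by positivity)]
          linarith
      _ = _ := by field_simp
  have hunit : ENNReal.ofReal (1 / 100 * (1 / (α * √((m + 1 : ℕ) : ℝ))) *
        √(1 - α ^ 2) ^ (m + 2)) *
        volume (Metric.closedBall (0 : EuclideanSpace ℝ (Fin (m + 1))) 1) ≤
      volume {x : EuclideanSpace ℝ (Fin (m + 1)) | ‖x‖ ≤ 1 ∧ α ≤ x 0} :=
    calc _ ≤ _ := mul_le_mul_right (EuclideanSpace.volume_closedBall_one_succ_le hm) _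
      _ ≤ _ := by
        rw [← mul_assoc, ← ENNReal.ofReal_mul (by positivity)]
        exact mul_le_mul_left (ENNReal.ofReal_le_ofReal hconst) _
      _ ≤ _ := EuclideanSpace.le_volume_unit_cap hα₀ hα₂ hαd
  rw [EuclideanSpace.volume_cap_eq _ hr, hrpow, Measure.addHaar_closedBall' _ _ hr.le,
    finrank_euclideanSpace_fin, mul_left_comm]
  exact mul_le_mul_right hunit _
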